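/- (Theorem 2, Eq. (4)). Let P be an n×n real row-stochastic matrix with P_{ii} ≠ 1 and P_{si} ≠ 1 for all s ≠ i, let π ∈ ℝⁿ satisfy πP = π, Σ_k π_k = 1, π_k ≥ 0, and let λ_{ij} (j ≠ i) be real constants. Define the n×n matrix M by M_{ii} = 1; M_{ij} = −P_{ij}/(1−P_{ii}) for j ≠ i; M_{si} = −λ_{is}P_{is}/(1−P_{ii}) for s ≠ i; M_{st} = λ_{is}P_{is}P_{st}/((1−P_{ii})(1−P_{si})) for s,t ≠ i. Let M_i be M with its i-th column removed. Assume Iₙ₋₁ − Z_i is invertible and d := 1 + 𝟏'(Iₙ₋₁ − Z_i)⁻¹ α_i ≠ 0. If the row vector x ∈ ℝⁿ satisfies x(Iₙ − P) = πM and Σ_k x_k = 0 (so that x is the derivative dπ/dP_{ii} under the globalization perturbation), then x_i = − 𝟏'(Iₙ₋₁ − Z_i)⁻¹ (πM_i)' / d. -/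

import Mathlib

open Matrix BigOperators

/-- `Zmat P i` is the transpose of `P` with its `i`-th row and `i`-th column removed:
`(Zmat P i) s t = P t s` for indices `s, t ≠ i`. -/
def Zmat {n : ℕ} (P : Matrix (Fin (n + 1)) (Fin (n + 1)) ℝ) (i : Fin (n + 1)) :
    Matrix (Fin n) (Fin n) ℝ :=
  Matrix.of fun s t => P (i.succAbove t) (i.succAbove s)

/-- `alphaVec P i` is the `i`-th row of `P` with its `i`-th entry dropped. -/
def alphaVec {n : ℕ} (P : Matrix (Fin (n + 1)) (Fin (n + 1)) ℝ) (i : Fin (n + 1)) :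
    Fin n → ℝ :=
  fun s => P i (i.succAbove s)

/-- `dropIdx i w` is the vector `w` with its `i`-th entry removed. -/
def dropIdx {n : ℕ} (i : Fin (n + 1)) (w : Fin (n + 1) → ℝ) : Fin n → ℝ :=
  fun s => w (i.succAbove s)

/-- The all-ones column vector in `ℝⁿ`. -/
def ones (n : ℕ) : Fin n → ℝ := fun _ => 1
/-- The globalization perturbation matrix `M` (so `ΔP = ΔP_{ii} · M`): `M_{ii} = 1`;
`M_{it} = −P_{it}/(1−P_{ii})` for `t ≠ i`; `M_{si} = −λ_{is} P_{is}/(1−P_{ii})` for `s ≠ i`;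
`M_{st} = λ_{is} P_{is} P_{st}/((1−P_{ii})(1−P_{si}))` for `s, t ≠ i`. -/
noncomputable def Mmat {n : ℕ} (P : Matrix (Fin (n + 1)) (Fin (n + 1)) ℝ) (i : Fin (n + 1))
    (lam : Fin (n + 1) → ℝ) : Matrix (Fin (n + 1)) (Fin (n + 1)) ℝ :=
  Matrix.of fun s t =>
    if s = i then
      if t = i then 1 else -P i t / (1 - P i i)
    else
      if t = i then -(lam s * P i s) / (1 - P i i)
      else lam s * P i s * P s t / ((1 - P i i) * (1 - P s i))

/-- Removing the `i`-th coordinate from `x ᵥ* (1 - P) = w` gives a linear system for the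
remaining coordinates of `x` with matrix `1 - Zmat P i`. -/
theorem one_sub_Zmat_mulVec_dropIdx {n : ℕ} {P : Matrix (Fin (n + 1)) (Fin (n + 1)) ℝ}
    {x w : Fin (n + 1) → ℝ} (h : x ᵥ* (1 - P) = w) (i : Fin (n + 1)) :
    (1 - Zmat P i) *ᵥ dropIdx i x = x i • alphaVec P i + dropIdx i w := by
  ext s
  have hs := congrFun h (i.succAbove s)
  rw [vecMul_sub, vecMul_one, Pi.sub_apply] at hs
  simp only [vecMul, dotProduct, Fin.sum_univ_succAbove _ i] at hs
  rw [sub_mulVec, one_mulVec]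
  simp only [mulVec, dotProduct, Zmat, alphaVec, dropIdx, of_apply, Pi.sub_apply, Pi.add_apply,
    Pi.smul_apply, smul_eq_mul, mul_comm (P _ _)]
  linarith

/-- Theorem 2, Eq. (4): under the globalization perturbation, the derivative
`x = dπ/dP_{ii}` satisfies
`x_i = − 𝟏ᵀ (Iₙ₋₁ − Z_i)⁻¹ (π M_i)ᵀ / (1 + 𝟏ᵀ (Iₙ₋₁ − Z_i)⁻¹ α_i)`,
where `M_i` is `M` with its `i`-th column removed. -/
theorem globalization_derivative_i (n : ℕ) (P : Matrix (Fin (n + 1)) (Fin (n + 1)) ℝ)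
    (hpos : ∀ s t, 0 ≤ P s t) (hrow : ∀ s, ∑ t, P s t = 1)
    (i : Fin (n + 1)) (hii : P i i ≠ 1) (hsi : ∀ s, s ≠ i → P s i ≠ 1)
    (piv : Fin (n + 1) → ℝ)
    (hpi : piv ᵥ* P = piv) (hpisum : ∑ k, piv k = 1) (hpipos : ∀ k, 0 ≤ piv k)
    (lam : Fin (n + 1) → ℝ)
    (hinv : IsUnit (1 - Zmat P i).det)
    (hd : 1 + ones n ⬝ᵥ ((1 - Zmat P i)⁻¹ *ᵥ alphaVec P i) ≠ 0)
    (x : Fin (n + 1) → ℝ)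
    (hsol : x ᵥ* (1 - P) = piv ᵥ* Mmat P i lam) (hx : ∑ k, x k = 0) :
    x i = -(ones n ⬝ᵥ ((1 - Zmat P i)⁻¹ *ᵥ dropIdx i (piv ᵥ* Mmat P i lam))) /
      (1 + ones n ⬝ᵥ ((1 - Zmat P i)⁻¹ *ᵥ alphaVec P i)) := by
  have hdrop : dropIdx i x =
      (1 - Zmat P i)⁻¹ *ᵥ (x i • alphaVec P i + dropIdx i (piv ᵥ* Mmat P i lam)) := by
    rw [← one_sub_Zmat_mulVec_dropIdx hsol i, mulVec_mulVec, nonsing_inv_mul _ hinv, one_mulVec]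
  have hsum : ones n ⬝ᵥ dropIdx i x = -x i := by
    rw [Fin.sum_univ_succAbove _ i] at hx
    simp only [dotProduct, ones, dropIdx, one_mul]
    linarith
  rw [hdrop, mulVec_add, mulVec_smul, dotProduct_add, dotProduct_smul, smul_eq_mul] at hsum
  rw [eq_div_iff hd]
  linarith
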